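/- If the operator T_B : D(T_B) ⊂ Y_B → Y_B is bijective, then the sequence (Aₘ)_{m∈ℤ} admits an exponential dichotomy with respect to the norms ‖·‖ₘ: there exist projections Pₘ commuting with the dynamics, invertibility of Aₘ on ker Pₘ, and constants D > 0 and t ∈ (0,1) such that ‖A(n,m)Pₘx‖ₙ ≤ D t^{n−m}‖x‖ₘ for n ≥ m and ‖A(n,m)Qₘx‖ₙ ≤ D t^{m−n}‖x‖ₘ for n ≤ m. -/

import Mathlib

/-- A Banach sequence space: a linear subspace of the real sequences indexed by `ℤ`,
with a norm that is monotone with respect to pointwise absolute value, and complete. -/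
structure BanachSeqSpace where
  mem : (ℤ → ℝ) → Prop
  bnorm : (ℤ → ℝ) → ℝ
  zero_mem : mem 0
  add_mem : ∀ {s t : ℤ → ℝ}, mem s → mem t → mem (s + t)
  smul_mem : ∀ (c : ℝ) {s : ℤ → ℝ}, mem s → mem (c • s)
  bnorm_nonneg : ∀ s : ℤ → ℝ, 0 ≤ bnorm s
  bnorm_eq_zero : ∀ {s : ℤ → ℝ}, mem s → (bnorm s = 0 ↔ s = 0)
  bnorm_add_le : ∀ {s t : ℤ → ℝ}, mem s → mem t → bnorm (s + t) ≤ bnorm s + bnorm t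
  bnorm_smul : ∀ (c : ℝ) (s : ℤ → ℝ), bnorm (c • s) = |c| * bnorm s
  mono_mem : ∀ {s t : ℤ → ℝ}, mem t → (∀ n, |s n| ≤ |t n|) → mem s
  mono_norm : ∀ {s t : ℤ → ℝ}, mem t → (∀ n, |s n| ≤ |t n|) → bnorm s ≤ bnorm t
  complete : ∀ u : ℕ → ℤ → ℝ, (∀ k, mem (u k)) →
    (∀ ε : ℝ, 0 < ε → ∃ K : ℕ, ∀ k l, K ≤ k → K ≤ l → bnorm (u k - u l) < ε) →
    ∃ s : ℤ → ℝ, mem s ∧ ∀ ε : ℝ, 0 < ε → ∃ K : ℕ, ∀ k, K ≤ k → bnorm (u k - s) < ε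

/-- An admissible Banach sequence space: contains the characteristic functions of
singletons with positive norm, and is invariant under shifts with a uniform bound `N`. -/
structure AdmissibleSeqSpace extends BanachSeqSpace where
  N : ℝ
  N_pos : 0 < N
  indicator_mem : ∀ n : ℤ, mem (fun k => if k = n then (1 : ℝ) else 0)
  indicator_pos : ∀ n : ℤ, 0 < bnorm (fun k => if k = n then (1 : ℝ) else 0)
  shift_mem : ∀ {s : ℤ → ℝ}, mem s → ∀ m : ℤ, mem (fun n => s (n + m))
  shift_norm : ∀ {s : ℤ → ℝ}, mem s → ∀ m : ℤ, bnorm (fun n => s (n + m)) ≤ N * bnorm s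

/-- `opComp A k m` is the composition `A(m+k, m) = A_{m+k-1} ∘ ⋯ ∘ A_m`
(the identity when `k = 0`). -/
def opComp {X : Type*} [NormedAddCommGroup X] [NormedSpace ℝ X]
    (A : ℤ → X →L[ℝ] X) : ℕ → ℤ → X →L[ℝ] X
  | 0, _ => ContinuousLinearMap.id ℝ X
  | k + 1, m => (A (m + k)).comp (opComp A k m)

section

open Filter Topology

namespace AdmissibleSeqSpace

variable (B : AdmissibleSeqSpace)

theorem mem_sub {s t : ℤ → ℝ} (hs : B.mem s) (ht : B.mem t) : B.mem (s - t) := by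
  rw [sub_eq_add_neg, ← neg_one_smul ℝ t]
  exact B.add_mem hs (B.smul_mem _ ht)

theorem abs_apply_mul_bnorm_indicator_le {s : ℤ → ℝ} (hs : B.mem s) (n : ℤ) :
    |s n| * B.bnorm (fun k => if k = n then (1 : ℝ) else 0) ≤ B.bnorm s := by
  rw [← abs_abs, ← B.bnorm_smul]
  refine B.mono_norm hs fun k => ?_
  by_cases hk : k = n <;> simp [hk]

theorem bnorm_indicator_le (m n : ℤ) :
    B.bnorm (fun k => if k = n then (1 : ℝ) else 0) ≤
      B.N * B.bnorm (fun k => if k = m then (1 : ℝ) else 0) := by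
  have h : (fun k : ℤ => if k = n then (1 : ℝ) else 0) =
      fun k => (fun j : ℤ => if j = m then (1 : ℝ) else 0) (k + (m - n)) := by
    funext k
    have : k + (m - n) = m ↔ k = n := by omega
    simp only [this]
  rw [h]
  exact B.shift_norm (B.indicator_mem m) (m - n)

end AdmissibleSeqSpace

/-- A family of norms on `X` indexed by `ℤ`, each equivalent to the norm of `X`. -/
structure EquivNorms (X : Type*) [NormedAddCommGroup X] [NormedSpace ℝ X] where
  toSeminorm : ℤ → Seminorm ℝ X
  equiv : ∀ n : ℤ, ∃ c C : ℝ, 0 < c ∧ 0 < C ∧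
    ∀ v : X, c * ‖v‖ ≤ toSeminorm n v ∧ toSeminorm n v ≤ C * ‖v‖

variable {X : Type*} [NormedAddCommGroup X] [NormedSpace ℝ X]

theorem EquivNorms.eq_zero (p : EquivNorms X) {n : ℤ} {v : X} (h : p.toSeminorm n v = 0) :
    v = 0 := by
  obtain ⟨c, C, hc, -, hcC⟩ := p.equiv n
  have := (hcC v).1
  rw [h] at this
  exact norm_le_zero_iff.1 (nonpos_of_mul_nonpos_right this hc)

/-- The submodule of sequences `x` for which `(‖xₙ‖ₙ)ₙ` lies in `B`. -/
def seqSubmodule (B : AdmissibleSeqSpace) (p : EquivNorms X) : Submodule ℝ (ℤ → X) where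
  carrier := {x | B.mem fun n => p.toSeminorm n (x n)}
  zero_mem' := by
    change B.mem fun n => p.toSeminorm n 0
    simp only [map_zero]
    exact B.zero_mem
  add_mem' {x y} hx hy := by
    refine B.mono_mem (B.add_mem hx hy) fun n => ?_
    rw [abs_of_nonneg (apply_nonneg _ _)]
    exact (map_add_le_add _ _ _).trans (le_abs_self _)
  smul_mem' c x hx := by
    refine B.mono_mem (B.smul_mem c hx) fun n => ?_
    simp [map_smul_eq_mul, abs_mul]

/-- The space `Y_B` of sequences `x` for which `(‖xₙ‖ₙ)ₙ` lies in `B`, normed by the norm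
of that sequence in `B`. -/
def SeqSpace (B : AdmissibleSeqSpace) (p : EquivNorms X) : Type _ := seqSubmodule B p

namespace SeqSpace

variable {B : AdmissibleSeqSpace} {p : EquivNorms X}

instance : AddCommGroup (SeqSpace B p) := inferInstanceAs (AddCommGroup (seqSubmodule B p))

instance : Module ℝ (SeqSpace B p) := inferInstanceAs (Module ℝ (seqSubmodule B p))

/-- The underlying sequence. -/
@[coe] def toFun (x : SeqSpace B p) : ℤ → X := Subtype.val x

instance : CoeFun (SeqSpace B p) fun _ => ℤ → X := ⟨toFun⟩

/-- The element of `Y_B` given by a sequence. -/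
def ofMem (x : ℤ → X) (hx : B.mem fun n => p.toSeminorm n (x n)) : SeqSpace B p := ⟨x, hx⟩

@[simp] theorem ofMem_apply (x : ℤ → X) (hx : B.mem fun n => p.toSeminorm n (x n)) (n : ℤ) :
    (ofMem x hx : SeqSpace B p) n = x n := rfl

@[simp] theorem coe_add_apply (x y : SeqSpace B p) (n : ℤ) : (x + y) n = x n + y n := rfl

@[simp] theorem coe_sub_apply (x y : SeqSpace B p) (n : ℤ) : (x - y) n = x n - y n := rfl

@[simp] theorem coe_zero_apply (n : ℤ) : (0 : SeqSpace B p) n = 0 := rfl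

@[simp] theorem coe_smul_apply (c : ℝ) (x : SeqSpace B p) (n : ℤ) : (c • x) n = c • x n := rfl

@[ext] theorem ext {x y : SeqSpace B p} (h : ∀ n, x n = y n) : x = y :=
  Subtype.ext (funext h)

theorem mem (x : SeqSpace B p) : B.mem fun n => p.toSeminorm n (x n) := x.2

instance : Norm (SeqSpace B p) := ⟨fun x => B.bnorm fun n => p.toSeminorm n (x n)⟩

theorem norm_def (x : SeqSpace B p) : ‖x‖ = B.bnorm fun n => p.toSeminorm n (x n) := rfl

theorem norm_core : NormedSpace.Core ℝ (SeqSpace B p) where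
  norm_nonneg _ := B.bnorm_nonneg _
  norm_smul c x := by
    simp only [norm_def, coe_smul_apply, map_smul_eq_mul, Real.norm_eq_abs]
    exact (B.bnorm_smul |c| _).trans (by rw [abs_abs])
  norm_triangle x y := by
    refine (B.mono_norm (B.add_mem x.mem y.mem) fun n => ?_).trans (B.bnorm_add_le x.mem y.mem)
    rw [abs_of_nonneg (apply_nonneg _ _)]
    exact (map_add_le_add _ _ _).trans (le_abs_self _)
  norm_eq_zero_iff x := by
    rw [norm_def, B.bnorm_eq_zero x.mem]
    constructor
    · intro h
      ext n
      exact p.eq_zero (congrFun h n)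
    · rintro rfl
      funext n
      simp

noncomputable instance : NormedAddCommGroup (SeqSpace B p) := NormedAddCommGroup.ofCore norm_core

noncomputable instance : NormedSpace ℝ (SeqSpace B p) := NormedSpace.ofCore norm_core

theorem apply_mul_bnorm_le (x : SeqSpace B p) (n : ℤ) :
    p.toSeminorm n (x n) * B.bnorm (fun k => if k = n then (1 : ℝ) else 0) ≤ ‖x‖ := by
  have := B.abs_apply_mul_bnorm_indicator_le x.mem n
  rwa [abs_of_nonneg (apply_nonneg _ _)] at this

theorem apply_mul_le (x : SeqSpace B p) (n : ℤ) :
    p.toSeminorm n (x n) * B.bnorm (fun k => if k = 0 then (1 : ℝ) else 0) ≤ B.N * ‖x‖ := by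
  refine (mul_le_mul_of_nonneg_left (B.bnorm_indicator_le n 0) (apply_nonneg _ _)).trans ?_
  rw [mul_left_comm]
  exact mul_le_mul_of_nonneg_left (x.apply_mul_bnorm_le n) B.N_pos.le

variable (B p) in
/-- Evaluation at `n`, as a continuous linear map. -/
noncomputable def eval (n : ℤ) : SeqSpace B p →L[ℝ] X :=
  LinearMap.mkContinuousOfExistsBound
    { toFun := fun x => x n
      map_add' := fun _ _ => rfl
      map_smul' := fun _ _ => rfl } (by
    obtain ⟨c, C, hc, -, hcC⟩ := p.equiv n
    have he := B.indicator_pos n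
    refine ⟨(c * B.bnorm (fun k => if k = n then (1 : ℝ) else 0))⁻¹, fun x => ?_⟩
    rw [inv_mul_eq_div, le_div_iff₀ (mul_pos hc he)]
    calc ‖x n‖ * (c * B.bnorm (fun k => if k = n then (1 : ℝ) else 0))
        = c * ‖x n‖ * B.bnorm (fun k => if k = n then (1 : ℝ) else 0) := by ring
      _ ≤ p.toSeminorm n (x n) * B.bnorm (fun k => if k = n then (1 : ℝ) else 0) :=
          mul_le_mul_of_nonneg_right (hcC _).1 he.le
      _ ≤ ‖x‖ := x.apply_mul_bnorm_le n)

@[simp] theorem eval_apply (n : ℤ) (x : SeqSpace B p) : eval B p n x = x n := rfl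

theorem exists_tendsto_of_cauchySeq [CompleteSpace X] {u : ℕ → SeqSpace B p} (hu : CauchySeq u) :
    ∃ x : ℤ → X, ∀ n, Tendsto (fun k => u k n) atTop (𝓝 (x n)) := by
  choose x hx using fun n =>
    cauchySeq_tendsto_of_complete ((eval B p n).uniformContinuous.comp_cauchySeq hu)
  exact ⟨x, hx⟩

theorem continuous_toSeminorm (p : EquivNorms X) (n : ℤ) : Continuous (p.toSeminorm n) := by
  obtain ⟨c, C, -, hC, hcC⟩ := p.equiv n
  refine Seminorm.continuous_of_le (q := C.toNNReal • normSeminorm ℝ X) ?_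
    fun v => (hcC v).2.trans_eq (by simp [NNReal.smul_def, hC.le])
  exact continuous_const.mul continuous_norm

/-- A pointwise limit of a Cauchy sequence in `Y_B` lies in `Y_B`, and its norm is at most the
limit of the norms. -/
theorem mem_and_norm_lt_of_cauchySeq {u : ℕ → SeqSpace B p} (hu : CauchySeq u) {x : ℤ → X}
    (hx : ∀ n, Tendsto (fun k => u k n) atTop (𝓝 (x n))) :
    ∃ h : B.mem fun n => p.toSeminorm n (x n),
      ∀ ε > 0, ∀ᶠ k in atTop, ‖(ofMem x h : SeqSpace B p)‖ < ‖u k‖ + ε := by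
  obtain ⟨s, hs, hus⟩ := B.complete (fun k n => p.toSeminorm n (u k n)) (fun k => (u k).mem) <| by
    intro ε hε
    obtain ⟨K, hK⟩ := Metric.cauchySeq_iff.1 hu ε hε
    refine ⟨K, fun k l hk hl => lt_of_le_of_lt ?_ (hK k hk l hl)⟩
    rw [dist_eq_norm]
    refine B.mono_norm (u k - u l).mem fun n => ?_
    rw [abs_of_nonneg (apply_nonneg (p.toSeminorm n) _)]
    exact abs_sub_map_le_sub (p.toSeminorm n) _ _
  have hsx : s = fun n => p.toSeminorm n (x n) := by
    funext n
    refine tendsto_nhds_unique (f := fun k => p.toSeminorm n (u k n)) (l := atTop) ?_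
      (((continuous_toSeminorm p n).tendsto _).comp (hx n))
    have he := B.indicator_pos n
    refine Metric.tendsto_atTop.2 fun ε hε => ?_
    obtain ⟨K, hK⟩ := hus _ (mul_pos hε he)
    refine ⟨K, fun k hk => lt_of_mul_lt_mul_right (lt_of_le_of_lt ?_ (hK k hk)) he.le⟩
    exact B.abs_apply_mul_bnorm_indicator_le (B.mem_sub (u k).mem hs) n
  subst hsx
  refine ⟨hs, fun ε hε => ?_⟩
  obtain ⟨K, hK⟩ := hus ε hε
  filter_upwards [eventually_ge_atTop K] with k hk
  set d : ℤ → ℝ := (fun n => p.toSeminorm n (u k n)) - fun n => p.toSeminorm n (x n) with hd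
  have hdm : B.mem d := B.mem_sub (u k).mem hs
  have hdn : B.bnorm ((-1 : ℝ) • d) = B.bnorm d := by rw [B.bnorm_smul]; simp
  have hsum : (fun n => p.toSeminorm n (x n)) =
      (fun n => p.toSeminorm n (u k n)) + (-1 : ℝ) • d := by
    funext n
    simp [hd]
  calc ‖(ofMem x hs : SeqSpace B p)‖
      = B.bnorm ((fun n => p.toSeminorm n (u k n)) + (-1 : ℝ) • d) := by
        rw [← hsum]; rfl
    _ ≤ ‖u k‖ + B.bnorm ((-1 : ℝ) • d) := B.bnorm_add_le (u k).mem (B.smul_mem _ hdm)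
    _ < ‖u k‖ + ε := by rw [hdn]; exact add_lt_add_right (hK k hk) _

instance [CompleteSpace X] : CompleteSpace (SeqSpace B p) := by
  refine Metric.complete_of_cauchySeq_tendsto fun u hu => ?_
  obtain ⟨x, hx⟩ := exists_tendsto_of_cauchySeq hu
  obtain ⟨hmem, -⟩ := mem_and_norm_lt_of_cauchySeq hu hx
  refine ⟨ofMem x hmem, Metric.tendsto_atTop.2 fun ε hε => ?_⟩
  obtain ⟨K, hK⟩ := Metric.cauchySeq_iff.1 hu (ε / 2) (half_pos hε)
  refine ⟨K, fun k hk => ?_⟩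
  have hsub : CauchySeq fun l => u k - u l :=
    (uniformContinuous_const.sub uniformContinuous_id).comp_cauchySeq hu
  obtain ⟨h, hlim⟩ := mem_and_norm_lt_of_cauchySeq hsub (x := fun n => u k n - x n)
    fun n => (tendsto_const_nhds (x := u k n)).sub (hx n)
  obtain ⟨l, hl, hlK⟩ := ((hlim (ε / 2) (half_pos hε)).and (eventually_ge_atTop K)).exists
  have h2 := hK k hk l hlK
  rw [dist_eq_norm] at h2 ⊢
  have : ‖u k - ofMem x hmem‖ < ‖u k - u l‖ + ε / 2 := hl
  linarith



theorem toSeminorm_pulse (p : EquivNorms X) (m : ℤ) (v : X) :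
    (fun n => p.toSeminorm n (if n = m then v else 0)) =
      p.toSeminorm m v • fun n => if n = m then (1 : ℝ) else 0 := by
  funext n
  by_cases h : n = m
  · subst h; simp
  · simp [h]

variable (B p) in
/-- The sequence that equals `v` at `m` and vanishes elsewhere, as a function of `v`. -/
noncomputable def pulse (m : ℤ) : X →L[ℝ] SeqSpace B p :=
  LinearMap.mkContinuousOfExistsBound
    { toFun := fun v => ofMem (fun n => if n = m then v else 0) (by
        rw [toSeminorm_pulse]
        exact B.smul_mem _ (B.indicator_mem m))
      map_add' := fun u v => by
        ext n
        by_cases h : n = m <;> simp [h]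
      map_smul' := fun c v => by
        ext n
        by_cases h : n = m <;> simp [h] } (by
    obtain ⟨c, C, -, -, hcC⟩ := p.equiv m
    refine ⟨C * B.bnorm (fun k => if k = m then (1 : ℝ) else 0), fun v => ?_⟩
    change B.bnorm (fun n => p.toSeminorm n (if n = m then v else 0)) ≤ _
    rw [toSeminorm_pulse, B.bnorm_smul, abs_of_nonneg (apply_nonneg _ _), mul_right_comm]
    exact mul_le_mul_of_nonneg_right (hcC v).2 (B.bnorm_nonneg _))

theorem pulse_apply (m : ℤ) (v : X) (n : ℤ) : pulse B p m v n = if n = m then v else 0 := rfl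

@[simp] theorem pulse_apply_self (m : ℤ) (v : X) : pulse B p m v m = v := if_pos rfl

theorem pulse_apply_of_ne {m n : ℤ} (h : n ≠ m) (v : X) : pulse B p m v n = 0 := if_neg h

theorem norm_pulse_le (m : ℤ) (v : X) :
    ‖pulse B p m v‖ ≤
      p.toSeminorm m v * (B.N * B.bnorm (fun k => if k = 0 then (1 : ℝ) else 0)) := by
  change B.bnorm (fun n => p.toSeminorm n (if n = m then v else 0)) ≤ _
  rw [toSeminorm_pulse, B.bnorm_smul, abs_of_nonneg (apply_nonneg _ _)]
  exact mul_le_mul_of_nonneg_left (B.bnorm_indicator_le 0 m) (apply_nonneg _ _)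

/-- A sequence dominated pointwise by an element of `Y_B` lies in `Y_B`. -/
theorem mem_of_le (x : SeqSpace B p) {z : ℤ → X}
    (h : ∀ n, p.toSeminorm n (z n) ≤ p.toSeminorm n (x n)) :
    B.mem fun n => p.toSeminorm n (z n) :=
  B.mono_mem x.mem fun n => by
    rw [abs_of_nonneg (apply_nonneg _ _), abs_of_nonneg (apply_nonneg _ _)]
    exact h n

theorem abs_multiplier_le (x : SeqSpace B p) {b : ℤ → ℝ} {δ : ℝ} (hb : ∀ n, |b n| ≤ δ) (n : ℤ) :
    |p.toSeminorm n (b n • x n)| ≤ |(δ • fun n => p.toSeminorm n (x n)) n| := by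
  rw [map_smul_eq_mul, Pi.smul_apply, smul_eq_mul, abs_mul, abs_mul, Real.norm_eq_abs, abs_abs]
  exact mul_le_mul_of_nonneg_right ((hb n).trans (le_abs_self δ)) (abs_nonneg _)

/-- Pointwise multiplication by a bounded scalar sequence. -/
noncomputable def multiplier (b : ℤ → ℝ) (δ : ℝ) (hb : ∀ n, |b n| ≤ δ) :
    SeqSpace B p →L[ℝ] SeqSpace B p :=
  LinearMap.mkContinuous
    { toFun := fun x => ofMem (fun n => b n • x n)
        (B.mono_mem (B.smul_mem δ x.mem) (abs_multiplier_le x hb))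
      map_add' := fun x y => by
        ext n
        simp
      map_smul' := fun c x => by
        ext n
        simp [smul_comm c] } δ (fun x => by
    refine (B.mono_norm (B.smul_mem δ x.mem) (abs_multiplier_le x hb)).trans ?_
    rw [B.bnorm_smul, abs_of_nonneg ((abs_nonneg _).trans (hb 0))]
    rfl)

@[simp] theorem multiplier_apply (b : ℤ → ℝ) (δ : ℝ) (hb : ∀ n, |b n| ≤ δ) (x : SeqSpace B p)
    (n : ℤ) : multiplier b δ hb x n = b n • x n := rfl

theorem norm_multiplier_le (b : ℤ → ℝ) (δ : ℝ) (hb : ∀ n, |b n| ≤ δ) :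
    ‖(multiplier b δ hb : SeqSpace B p →L[ℝ] SeqSpace B p)‖ ≤ δ :=
  LinearMap.mkContinuous_norm_le _ ((abs_nonneg _).trans (hb 0)) _

end SeqSpace

open SeqSpace

/-- `S` is the inverse of the operator `T_B`. -/
structure IsInverseOfTB {B : AdmissibleSeqSpace} {p : EquivNorms X} (A : ℤ → X →L[ℝ] X)
    (S : SeqSpace B p →L[ℝ] SeqSpace B p) : Prop where
  apply_sub : ∀ y n, S y n - A (n - 1) (S y (n - 1)) = y n
  eq_of_sub : ∀ x y : SeqSpace B p, (∀ n, x n - A (n - 1) (x (n - 1)) = y n) → S y = x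

theorem exists_isInverseOfTB [CompleteSpace X] (B : AdmissibleSeqSpace) (p : EquivNorms X)
    (A : ℤ → X →L[ℝ] X)
    (hinj : ∀ x1 x2 : SeqSpace B p,
      (∀ n, x1 n - A (n - 1) (x1 (n - 1)) = x2 n - A (n - 1) (x2 (n - 1))) → x1 = x2)
    (hsurj : ∀ y : SeqSpace B p, ∃ x : SeqSpace B p, ∀ n, x n - A (n - 1) (x (n - 1)) = y n) :
    ∃ S : SeqSpace B p →L[ℝ] SeqSpace B p, IsInverseOfTB A S := by
  choose s hs using hsurj
  have hs' : ∀ x y : SeqSpace B p, (∀ n, x n - A (n - 1) (x (n - 1)) = y n) → s y = x :=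
    fun x y h => hinj _ _ fun n => (hs y n).trans (h n).symm
  let S₀ : SeqSpace B p →ₗ[ℝ] SeqSpace B p :=
    { toFun := s
      map_add' := fun x y => hs' _ _ fun n => by
        simp only [coe_add_apply, map_add, ← hs x n, ← hs y n]
        abel
      map_smul' := fun c x => hs' _ _ fun n => by
        simp only [coe_smul_apply, map_smul, ← hs x n, smul_sub, RingHom.id_apply] }
  refine ⟨ContinuousLinearMap.ofSeqClosedGraph (g := S₀) fun u y x hu hx => ?_, hs, hs'⟩
  refine (hs' x y fun n => ?_).symm
  have he : ∀ {w : ℕ → SeqSpace B p} {z : SeqSpace B p}, Tendsto w atTop (𝓝 z) →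
      ∀ n, Tendsto (fun k => w k n) atTop (𝓝 (z n)) := fun hw n =>
    ((eval B p n).continuous.tendsto _).comp hw
  have h1 := (he hx n).sub (((A (n - 1)).continuous.tendsto _).comp (he hx (n - 1)))
  refine tendsto_nhds_unique h1 ((he hu n).congr fun k => ?_)
  exact (hs (u k) n).symm

namespace IsInverseOfTB

variable {B : AdmissibleSeqSpace} {p : EquivNorms X} {A : ℤ → X →L[ℝ] X}
  {S : SeqSpace B p →L[ℝ] SeqSpace B p}

theorem apply_pulse_add_one (hS : IsInverseOfTB A S) (m : ℤ) (v : X) :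
    S (pulse B p (m + 1) (A m v)) = S (pulse B p m v) - pulse B p m v := by
  refine hS.eq_of_sub _ _ fun n => ?_
  have h := hS.apply_sub (pulse B p m v) n
  simp only [coe_sub_apply, map_sub]
  rw [sub_sub_sub_comm, h, sub_sub_cancel]
  by_cases hn : n = m + 1
  · subst hn
    simp
  · rw [pulse_apply_of_ne hn, pulse_apply_of_ne (by omega), map_zero]

theorem apply_pulse_opComp (hS : IsInverseOfTB A S) (k : ℕ) (m : ℤ) (v : X) :
    S (pulse B p (m + (k + 1 : ℕ)) (opComp A (k + 1) m v)) m = S (pulse B p m v) m - v := by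
  induction k with
  | zero =>
    have := congrArg (fun x : SeqSpace B p => x m) (hS.apply_pulse_add_one m v)
    simpa [opComp] using this
  | succ k ih =>
    have := congrArg (fun x : SeqSpace B p => x m)
      (hS.apply_pulse_add_one (m + (k + 1 : ℕ)) (opComp A (k + 1) m v))
    rw [← ih]
    simp only [coe_sub_apply] at this
    rw [pulse_apply_of_ne (by omega), sub_zero, add_assoc] at this
    exact_mod_cast this

theorem opComp_apply_pulse (hS : IsInverseOfTB A S) (m : ℤ) (v : X) (k : ℕ) :
    opComp A k m (S (pulse B p m v) m) = S (pulse B p m v) (m + k) := by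
  induction k with
  | zero => simp [opComp]
  | succ k ih =>
    have h := hS.apply_sub (pulse B p m v) (m + (k + 1 : ℕ))
    rw [pulse_apply_of_ne (by omega), sub_eq_zero,
      show m + ((k + 1 : ℕ) : ℤ) - 1 = m + k by push_cast; ring] at h
    rw [h, ← ih]
    rfl

/-- Projecting the datum at `m` cuts the solution off before `m`. -/
theorem apply_pulse_apply_pulse (hS : IsInverseOfTB A S) (m : ℤ) (v : X) (n : ℤ) :
    S (pulse B p m (S (pulse B p m v) m)) n = if m ≤ n then S (pulse B p m v) n else 0 := by
  set x := S (pulse B p m v) with hx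
  have hz : B.mem fun n => p.toSeminorm n (if m ≤ n then x n else 0) :=
    x.mem_of_le fun n => by
      split_ifs
      · exact le_rfl
      · simp
  rw [hS.eq_of_sub (ofMem _ hz) _ fun n => ?_, ofMem_apply]
  have h := hS.apply_sub (pulse B p m v) n
  simp only [ofMem_apply]
  rcases lt_trichotomy n m with hn | rfl | hn
  · rw [if_neg (by omega), if_neg (by omega), pulse_apply_of_ne hn.ne]
    simp
  · simp
  · rw [if_pos hn.le, if_pos (by omega), pulse_apply_of_ne hn.ne']
    rwa [pulse_apply_of_ne hn.ne'] at h

/-- The perturbation of `T_B` by a small multiplier is still onto. -/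
theorem exists_add_multiplier [CompleteSpace X] {b : ℤ → ℝ} {δ : ℝ} (hb : ∀ n, |b n| ≤ δ)
    (hδ : ‖S‖ * δ ≤ 1 / 2) (y : SeqSpace B p) :
    ∃ x : SeqSpace B p, x = S (y - multiplier b δ hb x) ∧ ‖x‖ ≤ 2 * ‖S‖ * ‖y‖ := by
  set M : SeqSpace B p →L[ℝ] SeqSpace B p := multiplier b δ hb with hM
  have hSM : ‖S.comp M‖ ≤ 1 / 2 := (S.opNorm_comp_le M).trans <|
    (mul_le_mul_of_nonneg_left (norm_multiplier_le b δ hb) (norm_nonneg _)).trans hδ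
  have hlt : ‖-(S.comp M)‖ < 1 := by
    rw [norm_neg]
    linarith
  let u := Units.oneSub (-(S.comp M)) hlt
  have hx : (↑u⁻¹ : SeqSpace B p →L[ℝ] SeqSpace B p) (S y) +
      S (M ((↑u⁻¹ : SeqSpace B p →L[ℝ] SeqSpace B p) (S y))) = S y := by
    have h := congrArg (fun L : SeqSpace B p →L[ℝ] SeqSpace B p => L (S y)) u.mul_inv
    simpa [u] using h
  set x := (↑u⁻¹ : SeqSpace B p →L[ℝ] SeqSpace B p) (S y)
  have hx' : x = S (y - M x) := by rw [map_sub, ← hx, add_sub_cancel_right]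
  refine ⟨x, hx', ?_⟩
  have h1 : ‖x‖ ≤ ‖S y‖ + ‖S.comp M x‖ := by
    have : x = S y - S.comp M x := by rw [← hx]; simp
    calc ‖x‖ = ‖S y - S.comp M x‖ := congrArg _ this
      _ ≤ _ := norm_sub_le _ _
  have h2 := S.le_opNorm y
  have h3 := (S.comp M).le_of_opNorm_le hSM x
  linarith

theorem exists_decay [CompleteSpace X] (hS : IsInverseOfTB A S) :
    ∃ K t : ℝ, 0 < K ∧ 0 < t ∧ t < 1 ∧ ∀ (m n : ℤ) (v : X),
      p.toSeminorm n (S (pulse B p m v) n) ≤ K * t ^ (n - m).natAbs * p.toSeminorm m v := by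
  set δ : ℝ := 1 / (2 * (‖S‖ + 1)) with hδ
  have hS0 := norm_nonneg S
  have hδ0 : 0 < δ := by positivity
  have hSδ : ‖S‖ * δ ≤ 1 / 2 := by
    rw [hδ, mul_one_div, div_le_div_iff₀ (by positivity) (by norm_num)]
    linarith
  set t : ℝ := (1 + δ)⁻¹ with ht
  have ht0 : 0 < t := by positivity
  have ht1 : t < 1 := inv_lt_one_of_one_lt₀ (by linarith)
  have htδ : t⁻¹ = 1 + δ := inv_inv _
  have htδ' : 1 - t ≤ δ := by
    have : t * (1 + δ) = 1 := by rw [← htδ]; exact mul_inv_cancel₀ ht0.ne'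
    nlinarith
  have hN := B.N_pos
  refine ⟨2 * (‖S‖ + 1) * B.N ^ 2 * t⁻¹, t, by positivity, ht0, ht1, fun m n v => ?_⟩
  let q : ℤ → ℝ := fun n => t ^ (n - m).natAbs
  have hq0 : ∀ n, 0 < q n := fun n => pow_pos ht0 _
  have hq1 : ∀ n, q n ≤ 1 := fun n => pow_le_one₀ ht0.le ht1.le
  have hqm : q (m - 1) = t := by simp [q]
  have hb : ∀ n, |q n / q (n - 1) - 1| ≤ δ := by
    intro n
    rcases lt_or_ge n (m + 1) with hn | hn
    · have : q (n - 1) = q n * t := by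
        simp only [q]
        rw [← pow_succ]
        congr 1
        omega
      rw [this, ← div_div, div_self (hq0 n).ne', one_div, htδ, add_sub_cancel_left,
        abs_of_pos hδ0]
    · have : q n = q (n - 1) * t := by
        simp only [q]
        rw [← pow_succ]
        congr 1
        omega
      rw [this, mul_div_cancel_left₀ _ (hq0 _).ne', abs_sub_comm, abs_of_pos (by linarith)]
      exact htδ'
  obtain ⟨x, hx, hxn⟩ := exists_add_multiplier (S := S) hb hSδ (t⁻¹ • pulse B p m v)
  have hz : B.mem fun n => p.toSeminorm n (q n • x n) := x.mem_of_le fun n => by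
    rw [map_smul_eq_mul, Real.norm_eq_abs, abs_of_pos (hq0 n)]
    exact mul_le_of_le_one_left (apply_nonneg _ _) (hq1 n)
  have hSz : S (pulse B p m v) = ofMem _ hz := by
    refine hS.eq_of_sub _ _ fun n => ?_
    have h := hS.apply_sub (t⁻¹ • pulse B p m v - multiplier _ δ hb x) n
    rw [← hx] at h
    simp only [coe_sub_apply, coe_smul_apply, multiplier_apply] at h
    simp only [ofMem_apply, map_smul]
    have hA : A (n - 1) (x (n - 1)) =
        x n - (t⁻¹ • pulse B p m v n - (q n / q (n - 1) - 1) • x n) := by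
      rw [← h, sub_sub_cancel]
    have hq : q (n - 1) * (q n / q (n - 1)) = q n := mul_div_cancel₀ _ (hq0 _).ne'
    have hp : (q (n - 1) * t⁻¹) • pulse B p m v n = pulse B p m v n := by
      by_cases hn : n = m
      · subst hn
        rw [hqm, mul_inv_cancel₀ ht0.ne', one_smul]
      · rw [pulse_apply_of_ne hn, smul_zero]
    rw [hA, smul_sub, smul_sub, smul_smul, hp, smul_smul, mul_sub, hq, mul_one, sub_smul]
    abel
  rw [hSz, ofMem_apply, map_smul_eq_mul, Real.norm_eq_abs, abs_of_pos (hq0 n)]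
  set e := B.bnorm (fun k => if k = 0 then (1 : ℝ) else 0) with he
  have he0 : 0 < e := B.indicator_pos 0
  have hpv := apply_nonneg (p.toSeminorm m) v
  have hxe : p.toSeminorm n (x n) * e ≤
      2 * (‖S‖ + 1) * B.N ^ 2 * t⁻¹ * p.toSeminorm m v * e := by
    calc p.toSeminorm n (x n) * e ≤ B.N * ‖x‖ := x.apply_mul_le n
      _ ≤ B.N * (2 * ‖S‖ * (t⁻¹ * (p.toSeminorm m v * (B.N * e)))) := by
          gcongr
          refine hxn.trans ?_
          rw [norm_smul, Real.norm_eq_abs, abs_of_pos (inv_pos.2 ht0)]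
          gcongr
          exact norm_pulse_le m v
      _ ≤ B.N * (2 * (‖S‖ + 1) * (t⁻¹ * (p.toSeminorm m v * (B.N * e)))) := by
          gcongr
          linarith
      _ = _ := by ring
  have hxv := le_of_mul_le_mul_right hxe he0
  calc q n * p.toSeminorm n (x n)
      ≤ q n * (2 * (‖S‖ + 1) * B.N ^ 2 * t⁻¹ * p.toSeminorm m v) := by
        gcongr
    _ = _ := by ring

/-- The dichotomy projection at `m`, mapping `v` to the value at `m` of the solution with
datum `v` at `m`. -/
noncomputable def proj (S : SeqSpace B p →L[ℝ] SeqSpace B p) (m : ℤ) : X →L[ℝ] X :=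
  (eval B p m).comp (S.comp (pulse B p m))

theorem proj_apply (m : ℤ) (v : X) : proj S m v = S (pulse B p m v) m := rfl

theorem proj_proj (hS : IsInverseOfTB A S) (m : ℤ) (v : X) :
    proj S m (proj S m v) = proj S m v := by
  rw [proj_apply, proj_apply, hS.apply_pulse_apply_pulse, if_pos le_rfl]

theorem apply_proj (hS : IsInverseOfTB A S) (m : ℤ) (v : X) :
    A m (proj S m v) = proj S (m + 1) (A m v) := by
  have h := hS.apply_sub (pulse B p m v) (m + 1)
  rw [pulse_apply_of_ne (by omega), sub_eq_zero, add_sub_cancel_right] at h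
  rw [proj_apply, proj_apply, hS.apply_pulse_add_one, coe_sub_apply, pulse_apply_of_ne (by omega),
    sub_zero, h]

theorem bijOn_ker_proj (hS : IsInverseOfTB A S) (m : ℤ) :
    Set.BijOn (A m) {v : X | proj S m v = 0} {v : X | proj S (m + 1) v = 0} := by
  refine ⟨fun v hv => ?_, fun v hv w hw hvw => ?_, fun v hv => ?_⟩
  · rw [Set.mem_ofPred_eq] at hv ⊢
    rw [← hS.apply_proj, hv, map_zero]
  · rw [Set.mem_ofPred_eq] at hv hw
    have h := congrArg (fun x : SeqSpace B p => x m) (hS.apply_pulse_add_one m (v - w))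
    simp only [coe_sub_apply, pulse_apply_self, map_sub, hvw, sub_self, map_zero, coe_zero_apply] at h
    rw [← proj_apply, ← proj_apply, hv, hw, sub_zero, zero_sub, eq_comm, neg_eq_zero] at h
    exact sub_eq_zero.1 h
  · rw [Set.mem_ofPred_eq] at hv
    have hA := hS.apply_sub (pulse B p (m + 1) v) (m + 1)
    rw [← proj_apply, hv, pulse_apply_self, add_sub_cancel_right, zero_sub, ← map_neg] at hA
    refine ⟨_, ?_, hA⟩
    have h := congrArg (fun x : SeqSpace B p => x m)
      (hS.apply_pulse_add_one m (-S (pulse B p (m + 1) v) m))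
    rw [hA] at h
    simp only [coe_sub_apply, pulse_apply_self, sub_neg_eq_add] at h
    exact right_eq_add.1 h

/-- The backward solution along the unstable direction is given by the negative part of the
solution with datum `v` at `m`. -/
theorem eq_neg_apply_pulse (hS : IsInverseOfTB A S) (k : ℕ) (m : ℤ) (v w : X)
    (hw : proj S (m - (k + 1 : ℕ)) w = 0)
    (h : opComp A (k + 1) (m - (k + 1 : ℕ)) w = v - proj S m v) :
    w = -S (pulse B p m v) (m - (k + 1 : ℕ)) := by
  have h1 := hS.apply_pulse_opComp k (m - (k + 1 : ℕ)) w
  rw [← proj_apply, hw, zero_sub, sub_add_cancel, h, map_sub, map_sub, coe_sub_apply, proj_apply,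
    hS.apply_pulse_apply_pulse, if_neg (by omega), sub_zero] at h1
  rw [h1, neg_neg]

end IsInverseOfTB

end

/-- If `T_B : D(T_B) ⊂ Y_B → Y_B` is bijective, then `(Aₘ)` admits an exponential
dichotomy with respect to the norms `nn m`: there are projections `Pₘ` commuting with the
dynamics, with `Aₘ` invertible from `ker Pₘ` onto `ker P_{m+1}`, and constants `D > 0`,
`t ∈ (0,1)` such that `‖A(n,m)Pₘx‖ₙ ≤ D t^{n-m} ‖x‖ₘ` for `n ≥ m` and
`‖A(n,m)Qₘx‖ₙ ≤ D t^{m-n} ‖x‖ₘ` for `n ≤ m` (the latter stated via the backward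
solutions along the unstable directions). -/
theorem stmt13 (B : AdmissibleSeqSpace) {X : Type*} [NormedAddCommGroup X]
    [NormedSpace ℝ X] [CompleteSpace X]
    (A : ℤ → X →L[ℝ] X)
    (nn : ℤ → X → ℝ)
    (hnadd : ∀ (n : ℤ) (u v : X), nn n (u + v) ≤ nn n u + nn n v)
    (hnsmul : ∀ (n : ℤ) (c : ℝ) (v : X), nn n (c • v) = |c| * nn n v)
    (heq : ∀ n : ℤ, ∃ c C : ℝ, 0 < c ∧ 0 < C ∧
      ∀ v : X, c * ‖v‖ ≤ nn n v ∧ nn n v ≤ C * ‖v‖)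
    (hinj : ∀ x1 x2 : ℤ → X, B.mem (fun n => nn n (x1 n)) → B.mem (fun n => nn n (x2 n)) →
      (∀ n : ℤ, x1 n - A (n - 1) (x1 (n - 1)) = x2 n - A (n - 1) (x2 (n - 1))) → x1 = x2)
    (hsurj : ∀ y : ℤ → X, B.mem (fun n => nn n (y n)) →
      ∃ x : ℤ → X, B.mem (fun n => nn n (x n)) ∧
        ∀ n : ℤ, x n - A (n - 1) (x (n - 1)) = y n) :
    ∃ P : ℤ → X →L[ℝ] X,
      (∀ (m : ℤ) (v : X), P m (P m v) = P m v) ∧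
      (∀ (m : ℤ) (v : X), A m (P m v) = P (m + 1) (A m v)) ∧
      (∀ m : ℤ, Set.BijOn (A m) {v : X | P m v = 0} {v : X | P (m + 1) v = 0}) ∧
      ∃ D t : ℝ, 0 < D ∧ 0 < t ∧ t < 1 ∧
        (∀ (m : ℤ) (v : X) (k : ℕ),
          nn (m + k) (opComp A k m (P m v)) ≤ D * t ^ k * nn m v) ∧
        (∀ (k : ℕ) (m : ℤ) (v w : X), P (m - k) w = 0 →
          opComp A k (m - k) w = v - P m v →
          nn (m - k) w ≤ D * t ^ k * nn m v) := by
  let p : EquivNorms X := ⟨fun n => Seminorm.of (nn n) (hnadd n) (hnsmul n), heq⟩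
  obtain ⟨S, hS⟩ := exists_isInverseOfTB B p A
    (fun x1 x2 h => Subtype.ext (hinj x1 x2 x1.mem x2.mem h))
    (fun y => by
      obtain ⟨x, hx, h⟩ := hsurj y y.mem
      exact ⟨SeqSpace.ofMem x hx, h⟩)
  obtain ⟨K, t, hK, ht0, ht1, hdecay⟩ := hS.exists_decay
  refine ⟨IsInverseOfTB.proj S, hS.proj_proj, hS.apply_proj, hS.bijOn_ker_proj,
    1 + K, t, by positivity, ht0, ht1, fun m v k => ?_, fun k m v w hw h => ?_⟩
  · rw [IsInverseOfTB.proj_apply, hS.opComp_apply_pulse]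
    refine (hdecay m (m + k) v).trans ?_
    rw [add_sub_cancel_left, Int.natAbs_natCast]
    exact mul_le_mul_of_nonneg_right (mul_le_mul_of_nonneg_right (by linarith) (by positivity))
      (apply_nonneg (p.toSeminorm m) v)
  · have hv := apply_nonneg (p.toSeminorm m) v
    cases k with
    | zero =>
      simp only [opComp, Nat.cast_zero, sub_zero, ContinuousLinearMap.id_apply] at h ⊢
      have h1 := hdecay m m v
      rw [sub_self, Int.natAbs_zero, pow_zero, mul_one] at h1
      rw [h, pow_zero, mul_one, add_mul, one_mul]
      exact (map_sub_le_add (p.toSeminorm m) _ _).trans (add_le_add_right h1 _)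
    | succ k =>
      have h1 := hdecay m (m - (k + 1 : ℕ)) v
      rw [← map_neg_eq_map, ← hS.eq_neg_apply_pulse k m v w hw h,
        show (m - (k + 1 : ℕ) - m).natAbs = k + 1 by omega] at h1
      exact h1.trans (mul_le_mul_of_nonneg_right
        (mul_le_mul_of_nonneg_right (by linarith) (by positivity)) hv)
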